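/- arXiv:1910.08899 — 5 statements merged into one kernel-verified Lean document; each statement's English description precedes it below -/
import Mathlib

section
/- Let R be a finite commutative ring with identity and let A ∈ M_{s×s}(R) be a square matrix. Then A is invertible over R (equivalently, det(A) is a unit of R) if and only if A has full rank over R, i.e. the rows of A are linearly independent over R. -/
open Matrix BigOperators

noncomputable section

/-- The linear map sending a tuple of codewords `(c_1, …, c_s)` (each in `R^n`)
to the `n × l` matrix `(c_1 … c_s) A`. -/
def mpcMap {R : Type*} [CommRing R] {s l n : ℕ} (A : Matrix (Fin s) (Fin l) R) :
    (Fin s → Fin n → R) →ₗ[R] Matrix (Fin n) (Fin l) R where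
  toFun c := Matrix.of fun p t => ∑ i, c i p * A i t
  map_add' x y := by
    ext p t
    simp [add_mul, Finset.sum_add_distrib]
  map_smul' r x := by
    ext p t
    simp [Finset.mul_sum, mul_assoc]

/-- The matrix-product code `[C_1 … C_s] A`, viewed as a linear code of length `n·l`
inside `M_{n×l}(R)`. -/
def matrixProductCode {R : Type*} [CommRing R] {s l n : ℕ}
    (C : Fin s → Submodule R (Fin n → R)) (A : Matrix (Fin s) (Fin l) R) :
    Submodule R (Matrix (Fin n) (Fin l) R) :=
  (Submodule.pi Set.univ C).map (mpcMap A)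

/-- The (Euclidean) dual of a linear code `C ⊆ R^ι`. -/
def dualCode {R : Type*} [CommRing R] {ι : Type*} [Fintype ι] (C : Submodule R (ι → R)) :
    Submodule R (ι → R) where
  carrier := {x | ∀ y ∈ C, ∑ i, x i * y i = 0}
  add_mem' := by
    intro a b ha hb y hy
    simp only [Set.mem_setOf_eq] at ha hb
    simp [Pi.add_apply, add_mul, Finset.sum_add_distrib, ha y hy, hb y hy]
  zero_mem' := by intro y hy; simp
  smul_mem' := by
    intro r a ha y hy
    simp only [Set.mem_setOf_eq] at ha
    simp [Pi.smul_apply, smul_eq_mul, mul_assoc, ← Finset.mul_sum, ha y hy]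

/-- The dual of a code of `n × l` matrices, w.r.t. `⟨X,Y⟩ = tr (X Yᵀ) = ∑ᵢⱼ Xᵢⱼ Yᵢⱼ`. -/
def dualCodeMat {R : Type*} [CommRing R] {n l : ℕ}
    (C : Submodule R (Matrix (Fin n) (Fin l) R)) :
    Submodule R (Matrix (Fin n) (Fin l) R) where
  carrier := {x | ∀ y ∈ C, ∑ i, ∑ j, x i j * y i j = 0}
  add_mem' := by
    intro a b ha hb y hy
    simp only [Set.mem_setOf_eq] at ha hb
    simp [Matrix.add_apply, add_mul, Finset.sum_add_distrib, ha y hy, hb y hy]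
  zero_mem' := by intro y hy; simp
  smul_mem' := by
    intro r a ha y hy
    simp only [Set.mem_setOf_eq] at ha
    simp [Matrix.smul_apply, smul_eq_mul, mul_assoc, ← Finset.mul_sum, ha y hy]

/-- The minimum Hamming distance of a (linear) code `C ⊆ R^ι`:
the minimal Hamming weight of a nonzero codeword. -/
def minDist {R : Type*} [Zero R] [DecidableEq R] {ι : Type*} [Fintype ι]
    (C : Set (ι → R)) : ℕ :=
  sInf (hammingNorm '' {c ∈ C | c ≠ 0})

/-- The Hamming weight of an `n × l` matrix: the number of its nonzero entries. -/
def matWt {R : Type*} [Zero R] [DecidableEq R] {n l : ℕ}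
    (x : Matrix (Fin n) (Fin l) R) : ℕ :=
  hammingNorm fun p : Fin n × Fin l => x p.1 p.2

/-- The minimum Hamming distance of a code of `n × l` matrices
(regarded as words of length `n·l`). -/
def minDistMat {R : Type*} [Zero R] [DecidableEq R] {n l : ℕ}
    (C : Set (Matrix (Fin n) (Fin l) R)) : ℕ :=
  sInf (matWt '' {c ∈ C | c ≠ 0})

end

noncomputable section

/-- `rowSpanCode A i` is the submodule `C_{L_i}` of `R^l` generated by the rows
`L_1, …, L_i` of `A` (in 0-indexed terms, the rows `A j` with `j ≤ i`). -/
def rowSpanCode {R : Type*} [CommRing R] {s l : ℕ} (A : Matrix (Fin s) (Fin l) R)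
    (i : Fin s) : Submodule R (Fin l → R) :=
  Submodule.span R ((fun j => A j) '' {j : Fin s | j ≤ i})

end

/-- Over a finite commutative ring `R`, a square matrix
`A ∈ M_{s×s}(R)` is invertible (equivalently, `det A` is a unit of `R`) if and only if
`A` has full rank over `R`, i.e. its rows are linearly independent over `R`. -/
theorem matrix_invertible_iff_fullRank {R : Type*} [CommRing R] [Fintype R]
    {s : ℕ} (A : Matrix (Fin s) (Fin s) R) :
    (IsUnit A ↔ LinearIndependent R (fun i => A i)) ∧
    (IsUnit A.det ↔ LinearIndependent R (fun i => A i)) := by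
  have h : IsUnit A ↔ LinearIndependent R (fun i => A i) := by
    change _ ↔ LinearIndependent R A.row
    rw [← Matrix.vecMul_injective_iff, ← Matrix.vecMul_surjective_iff_isUnit]
    exact Finite.injective_iff_surjective.symm
  exact ⟨h, (Matrix.isUnit_iff_isUnit_det A).symm.trans h⟩
end

section
/- Let R be a finite commutative ring with identity, let A ∈ M_{s×l}(R) (s ≤ l) have full rank over R, and let C_i be a free linear code of length n and rank k_i over R for i = 1,…,s. Then the cardinality of the matrix-product code satisfies |[C_1 … C_s]A| = ∏_{i=1}^{s} |C_i|. -/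
open Matrix BigOperators

/-- If the rows of `A` are linearly independent, then `(c_1, …, c_s) ↦ (c_1 … c_s) A` is
injective. -/
theorem mpcMap_injective {R : Type*} [CommRing R] {s l n : ℕ} {A : Matrix (Fin s) (Fin l) R}
    (hA : LinearIndependent R (fun i => A i)) :
    Function.Injective (mpcMap (n := n) A) := by
  rw [injective_iff_map_eq_zero]
  intro c hc
  ext i p
  refine Fintype.linearIndependent_iff.mp hA (fun i => c i p) ?_ i
  ext t
  simpa [mpcMap] using congrFun (congrFun hc p) t

/-- If `R` is a finite commutative ring, `A ∈ M_{s×l}(R)` (`s ≤ l`) has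
full rank over `R`, and each `C i` is a free linear code of length `n` and rank `k i`
over `R`, then `|[C_1 … C_s] A| = ∏ i, |C i|`. -/
theorem matrixProductCode_card {R : Type*} [CommRing R] [Fintype R] {s l n : ℕ}
    (hsl : s ≤ l) (A : Matrix (Fin s) (Fin l) R)
    (hA : LinearIndependent R (fun i => A i))
    (C : Fin s → Submodule R (Fin n → R)) (k : Fin s → ℕ)
    (hfree : ∀ i, Module.Free R (C i))
    (hrank : ∀ i, Module.rank R (C i) = k i) :
    Nat.card (matrixProductCode C A) = ∏ i, Nat.card (C i) := by
  have image_card : Nat.card (matrixProductCode C A) = Nat.card (Submodule.pi Set.univ C) :=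
    (Nat.card_congr (Submodule.equivMapOfInjective (mpcMap A) (mpcMap_injective hA)
      (Submodule.pi Set.univ C)).toEquiv).symm
  let pi_equiv : (Submodule.pi Set.univ C) ≃ ∀ i, C i :=
    { toFun := fun c i => ⟨c.1 i, c.2 i (Set.mem_univ i)⟩
      invFun := fun c => ⟨fun i => c i, fun i _ => (c i).2⟩
      left_inv := fun _ => rfl
      right_inv := fun _ => rfl }
  rw [image_card, Nat.card_congr pi_equiv, Nat.card_pi]
end

section
/- Let R be a commutative ring with identity, let A ∈ M_{s×l}(R) have full rank over R, and let C_1,…,C_s be linear codes of length n over R with minimum Hamming distances d_1,…,d_s. For i = 1,…,s let D_i be the minimum Hamming distance of the R-submodule C_{L_i} of R^l generated by the first i rows of A. Then the minimum Hamming distance of the matrix-product code satisfies d([C_1 … C_s]A) ≥ min{d_1D_1, d_2D_2, …, d_sD_s}. -/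
open Matrix BigOperators

/-- If the rows of `A` are linearly independent, a tuple of words can be recovered
from its matrix product with `A`. -/
theorem mpcMap_row_eq_zero {R : Type*} [CommRing R] {s l n : ℕ}
    {A : Matrix (Fin s) (Fin l) R} (hA : LinearIndependent R (fun i => A i))
    {c : Fin s → Fin n → R} {p : Fin n} (h : mpcMap A c p = 0) (i : Fin s) :
    c i p = 0 := by
  refine Fintype.linearIndependent_iff.1 hA (fun j => c j p) ?_ i
  rw [← h]
  ext t
  simp [mpcMap, Finset.sum_apply]

/-- The rows of `(c_1 … c_s) A` lie in the span of the first `i` rows of `A`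
as soon as `c_j = 0` for all `j > i`. -/
theorem mpcMap_row_mem_rowSpanCode {R : Type*} [CommRing R] {s l n : ℕ}
    (A : Matrix (Fin s) (Fin l) R) {c : Fin s → Fin n → R} {i : Fin s}
    (h : ∀ j, i < j → c j = 0) (p : Fin n) : mpcMap A c p ∈ rowSpanCode A i := by
  have hrow : mpcMap A c p = ∑ j, c j p • A j := by
    ext t
    simp [mpcMap, Finset.sum_apply]
  rw [hrow]
  refine Submodule.sum_mem _ fun j _ => ?_
  rcases le_or_gt j i with hj | hj
  · exact Submodule.smul_mem _ _ (Submodule.subset_span ⟨j, hj, rfl⟩)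
  · simp [h j hj]

theorem minDist_le_hammingNorm {R : Type*} [Zero R] [DecidableEq R] {ι : Type*} [Fintype ι]
    {C : Set (ι → R)} {x : ι → R} (hx : x ∈ C) (h0 : x ≠ 0) :
    minDist C ≤ hammingNorm x :=
  Nat.sInf_le ⟨x, ⟨hx, h0⟩, rfl⟩

/-- The weight of a matrix is the sum of the weights of its rows. -/
theorem matWt_eq_sum {R : Type*} [Zero R] [DecidableEq R] {n l : ℕ}
    (x : Matrix (Fin n) (Fin l) R) : matWt x = ∑ p, hammingNorm (x p) := by
  simp only [matWt, hammingNorm, Finset.card_filter, Fintype.sum_prod_type]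

/-- A nonzero matrix product `(c_1 … c_s) A` has weight at least `d_i D_i`, where `i` is the
last index with `c_i ≠ 0`. -/
theorem minDist_mul_minDist_le_matWt {R : Type*} [CommRing R] [DecidableEq R] {s l n : ℕ}
    {A : Matrix (Fin s) (Fin l) R} (hA : LinearIndependent R (fun i => A i))
    {C : Fin s → Submodule R (Fin n → R)} {c : Fin s → Fin n → R} {i : Fin s}
    (hc : c i ∈ C i) (hi : c i ≠ 0) (h : ∀ j, i < j → c j = 0) :
    minDist (C i : Set (Fin n → R)) * minDist (rowSpanCode A i : Set (Fin l → R)) ≤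
      matWt (mpcMap A c) := by
  calc
    _ ≤ hammingNorm (c i) * minDist (rowSpanCode A i : Set (Fin l → R)) :=
      Nat.mul_le_mul_right _ (minDist_le_hammingNorm hc hi)
    _ = ∑ p with c i p ≠ 0, minDist (rowSpanCode A i : Set (Fin l → R)) := by
      rw [Finset.sum_const, smul_eq_mul, hammingNorm]
    _ ≤ ∑ p with c i p ≠ 0, hammingNorm (mpcMap A c p) := by
      refine Finset.sum_le_sum fun p hp => ?_
      exact minDist_le_hammingNorm (mpcMap_row_mem_rowSpanCode A h p)
        fun h0 => (Finset.mem_filter.1 hp).2 (mpcMap_row_eq_zero hA h0 i)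
    _ ≤ ∑ p, hammingNorm (mpcMap A c p) :=
      Finset.sum_le_sum_of_subset (Finset.filter_subset _ _)
    _ = _ := (matWt_eq_sum _).symm

/-- If `A ∈ M_{s×l}(R)` has full rank over a commutative ring `R` and
`C_1, …, C_s` are linear codes of length `n` over `R` with minimum Hamming distances
`d_i = minDist (C i)`, and `D_i = minDist C_{L_i}` where `C_{L_i}` is the submodule of
`R^l` generated by the first `i` rows of `A`, then
`d([C_1 … C_s] A) ≥ min_i (d_i · D_i)`. -/
theorem matrixProductCode_minDist_lower_bound {R : Type*} [CommRing R] [DecidableEq R]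
    {s l n : ℕ} (A : Matrix (Fin s) (Fin l) R)
    (hA : LinearIndependent R (fun i => A i))
    (C : Fin s → Submodule R (Fin n → R)) :
    sInf {w : ℕ | ∃ i : Fin s,
        w = minDist (C i : Set (Fin n → R)) *
            minDist (rowSpanCode A i : Set (Fin l → R))} ≤
      minDistMat (matrixProductCode C A : Set (Matrix (Fin n) (Fin l) R)) := by
  rcases Set.eq_empty_or_nonempty
    {x ∈ (matrixProductCode C A : Set (Matrix (Fin n) (Fin l) R)) | x ≠ 0} with hE | hE
  · have hC : ∀ i, minDist (C i : Set (Fin n → R)) = 0 := by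
      intro i
      have hempty : {v ∈ (C i : Set (Fin n → R)) | v ≠ 0} = ∅ := by
        refine Set.eq_empty_of_forall_notMem fun v hv => hv.2 ?_
        have hmem : mpcMap A (Pi.single i v) ∈ matrixProductCode C A := by
          refine ⟨Pi.single i v, fun j _ => ?_, rfl⟩
          rcases eq_or_ne j i with rfl | hj
          · simpa using hv.1
          · simp [hj]
        have h0 : mpcMap A (Pi.single i v) = 0 := by
          by_contra h0
          exact hE.subset ⟨hmem, h0⟩
        ext p
        simpa using mpcMap_row_eq_zero hA (congrFun h0 p) i
      rw [minDist, hempty, Set.image_empty, Nat.sInf_empty]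
    refine (Nat.sInf_eq_zero.2 ?_).trans_le (Nat.zero_le _)
    rcases isEmpty_or_nonempty (Fin s) with hs | ⟨⟨i⟩⟩
    · exact .inr (by simp)
    · exact .inl ⟨i, by simp [hC i]⟩
  · obtain ⟨x, ⟨⟨c, hc, rfl⟩, hx⟩, hwt⟩ := Nat.sInf_mem (hE.image matWt)
    have hne : (Finset.univ.filter fun i => c i ≠ 0).Nonempty := by
      by_contra hcon
      refine hx ?_
      have : c = 0 := by
        ext1 i
        by_contra hi
        exact hcon ⟨i, by simpa using hi⟩
      rw [this, map_zero]
    obtain ⟨i, hi, hmax⟩ := Finset.exists_max_image _ id hne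
    have hlast : ∀ j, i < j → c j = 0 := fun j hj => by
      by_contra h0
      exact (hmax j (by simpa using h0)).not_gt hj
    rw [minDistMat, ← hwt]
    refine le_trans (Nat.sInf_le ?_)
      (minDist_mul_minDist_le_matWt hA (hc i trivial) (Finset.mem_filter.1 hi).2 hlast)
    exact ⟨i, rfl⟩
end

section
/- Let R be a finite commutative ring with identity, let A ∈ M_{s×s}(R) be non-singular (det(A) a unit of R), and let C_1,…,C_s be free linear codes of length n over R. Then ([C_1 … C_s]A)^⊥ = [C_1^⊥ … C_s^⊥](A^{−1})^T. -/
open Matrix BigOperators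

theorem mpcMap_apply_eq_mul {R : Type*} [CommRing R] {s l n : ℕ}
    (A : Matrix (Fin s) (Fin l) R) (c : Fin s → Fin n → R) :
    mpcMap A c = (Matrix.of c)ᵀ * A := by
  ext p t
  simp [mpcMap, Matrix.mul_apply]

/-- Right multiplication by `A` and by `Aᵀ` are adjoint for the Euclidean form on matrices. -/
theorem sum_mul_mpcMap_apply {R : Type*} [CommRing R] {s l n : ℕ}
    (A : Matrix (Fin s) (Fin l) R) (X : Matrix (Fin n) (Fin l) R) (c : Fin s → Fin n → R) :
    ∑ p, ∑ t, X p t * mpcMap A c p t = ∑ i, ∑ p, (X * Aᵀ) p i * c i p := by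
  rw [Finset.sum_comm (f := fun i p => (X * Aᵀ) p i * c i p)]
  refine Finset.sum_congr rfl fun p _ => ?_
  simp only [mpcMap_apply_eq_mul, Matrix.mul_apply, Matrix.transpose_apply, Matrix.of_apply,
    Finset.mul_sum, Finset.sum_mul]
  rw [Finset.sum_comm]
  exact Finset.sum_congr rfl fun i _ => Finset.sum_congr rfl fun t _ => by ring

/-- A matrix `X` is orthogonal to `[C_1 … C_s] A` exactly when the `i`-th column of `X Aᵀ`
is orthogonal to `C_i` for every `i`. -/
theorem mem_dualCodeMat_matrixProductCode {R : Type*} [CommRing R] {s l n : ℕ}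
    (A : Matrix (Fin s) (Fin l) R) (C : Fin s → Submodule R (Fin n → R))
    (X : Matrix (Fin n) (Fin l) R) :
    X ∈ dualCodeMat (matrixProductCode C A) ↔ ∀ i, (X * Aᵀ)ᵀ i ∈ dualCode (C i) := by
  constructor
  · intro hX i y hy
    have hmem : Pi.single i y ∈ Submodule.pi Set.univ C := by
      intro j _
      obtain rfl | hj := eq_or_ne j i
      · simpa using hy
      · simp [Pi.single_eq_of_ne hj]
    have h := hX _ (Submodule.mem_map_of_mem hmem)
    rw [sum_mul_mpcMap_apply, Finset.sum_eq_single i] at h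
    · simpa using h
    · intro j _ hj
      simp [Pi.single_eq_of_ne hj]
    · simp
  · rintro h _ ⟨c, hc, rfl⟩
    rw [sum_mul_mpcMap_apply]
    exact Finset.sum_eq_zero fun i _ => h i (c i) (hc i trivial)

/-- If `R` is a finite commutative ring, `A ∈ M_{s×s}(R)` is
non-singular (`det A` is a unit), and `C_1, …, C_s` are free linear codes of length `n`
over `R`, then `([C_1 … C_s] A)^⊥ = [C_1^⊥ … C_s^⊥] (A⁻¹)ᵀ`. -/
theorem dual_matrixProductCode {R : Type*} [CommRing R] [Fintype R] {s n : ℕ}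
    (A : Matrix (Fin s) (Fin s) R) (hA : IsUnit A.det)
    (C : Fin s → Submodule R (Fin n → R)) (hfree : ∀ i, Module.Free R (C i)) :
    dualCodeMat (matrixProductCode C A) =
      matrixProductCode (fun i => dualCode (C i)) (A⁻¹)ᵀ := by
  ext X
  rw [mem_dualCodeMat_matrixProductCode]
  constructor
  · intro h
    refine ⟨fun i => (X * Aᵀ)ᵀ i, fun i _ => h i, ?_⟩
    rw [mpcMap_apply_eq_mul]
    change X * Aᵀ * (A⁻¹)ᵀ = X
    rw [Matrix.mul_assoc, ← Matrix.transpose_mul, Matrix.nonsing_inv_mul A hA,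
      Matrix.transpose_one, Matrix.mul_one]
  · rintro ⟨d, hd, rfl⟩ i
    rw [mpcMap_apply_eq_mul, Matrix.mul_assoc, ← Matrix.transpose_mul,
      Matrix.mul_nonsing_inv A hA, Matrix.transpose_one, Matrix.mul_one]
    exact hd i trivial
end

section
/- Let R be a finite commutative ring with identity, let A ∈ M_{s×s}(R) satisfy AA^T = Diag(r_1,…,r_s) with each r_i a unit of R, and let C_1,…,C_s be free linear codes over R of the same length n. Then the matrix-product code [C_1 … C_s]A is self-orthogonal if and only if C_i is self-orthogonal for every i = 1,…,s. -/
open Matrix BigOperators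

/-- If `A Aᵀ` is diagonal, the pairing of two matrix-product codewords is the weighted sum of
the pairings of their components. -/
theorem sum_mpcMap_mul_mpcMap {R : Type*} [CommRing R] {s l n : ℕ}
    {A : Matrix (Fin s) (Fin l) R} {r : Fin s → R} (hA : A * Aᵀ = Matrix.diagonal r)
    (c d : Fin s → Fin n → R) :
    ∑ p, ∑ t, mpcMap A c p t * mpcMap A d p t = ∑ i, r i * ∑ p, c i p * d i p := by
  have key (v w : Fin s → R) : (v ᵥ* A) ⬝ᵥ (w ᵥ* A) = ∑ i, r i * (v i * w i) := by
    rw [← mulVec_transpose A w, ← dotProduct_mulVec, mulVec_mulVec, hA]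
    simp only [dotProduct, mulVec_diagonal]
    exact Finset.sum_congr rfl fun i _ => by ring
  simp_rw [Finset.mul_sum]
  rw [Finset.sum_comm (s := (Finset.univ : Finset (Fin s)))]
  exact Finset.sum_congr rfl fun p _ => key (fun i => c i p) (fun i => d i p)

/-- Let `R` be a finite commutative ring and `A ∈ M_{s×s}(R)` with
`A Aᵀ = Diag(r_1, …, r_s)`, each `r_i` a unit, and let `C_1, …, C_s` be free linear
codes of length `n` over `R`.  Then `[C_1 … C_s] A` is self-orthogonal if and only if
every `C_i` is self-orthogonal. -/
theorem matrixProductCode_selfOrthogonal_iff {R : Type*} [CommRing R] [Fintype R]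
    {s n : ℕ} (A : Matrix (Fin s) (Fin s) R) (r : Fin s → R) (hr : ∀ i, IsUnit (r i))
    (hA : A * Aᵀ = Matrix.diagonal r)
    (C : Fin s → Submodule R (Fin n → R)) (hfree : ∀ i, Module.Free R (C i)) :
    matrixProductCode C A ≤ dualCodeMat (matrixProductCode C A) ↔
      ∀ i, C i ≤ dualCode (C i) := by
  constructor
  · intro h i x hx y hy
    have mem (z : Fin n → R) (hz : z ∈ C i) :
        mpcMap A (Pi.single i z) ∈ matrixProductCode C A := by
      refine Submodule.mem_map_of_mem fun j _ => ?_
      rcases eq_or_ne j i with rfl | hj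
      · simpa using hz
      · simp [hj]
    have hxy := h (mem x hx) _ (mem y hy)
    rw [sum_mpcMap_mul_mpcMap hA, Finset.sum_eq_single i] at hxy
    · simpa [(hr i).mul_right_eq_zero] using hxy
    · intro j _ hj
      simp [hj]
    · simp
  · rintro h _ ⟨c, hc, rfl⟩ _ ⟨d, hd, rfl⟩
    rw [sum_mpcMap_mul_mpcMap hA]
    refine Finset.sum_eq_zero fun i _ => ?_
    rw [h i (hc i trivial) _ (hd i trivial), mul_zero]
end
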